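/- Let O be a principal ideal domain with finite residue rings (residually finite), K its fraction field, p ∈ O a prime element, m ≥ 1, and U a K-subspace of K^ℓ. Then the cardinality of the p^m-torsion submodule of π(U) equals N(⟨p^m⟩)^{dim_K U}, where N(I) = #(O/I) and π : K^ℓ → (K/O)^ℓ is the canonical projection. -/

import Mathlib

noncomputable section

/-- The image of `O` in `K` as an `O`-submodule. -/
def OinK (O K : Type*) [CommRing O] [CommRing K] [Algebra O K] : Submodule O K :=
  LinearMap.range (Algebra.linearMap O K)

/-- The coordinatewise canonical projection `π : K^ℓ → (K/O)^ℓ`. -/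
def piMap (O K : Type*) [CommRing O] [CommRing K] [Algebra O K] (ℓ : ℕ) :
    (Fin ℓ → K) →ₗ[O] (Fin ℓ → K ⧸ OinK O K) :=
  LinearMap.pi fun i => (OinK O K).mkQ.comp (LinearMap.proj i)

/-- The image `π(U)` of a `K`-subspace `U ⊆ K^ℓ` under `π`, as an `O`-submodule of `(K/O)^ℓ`. -/
def piU (O : Type*) {K : Type*} [CommRing O] [CommRing K] [Algebra O K] {ℓ : ℕ}
    (U : Submodule K (Fin ℓ → K)) : Submodule O (Fin ℓ → K ⧸ OinK O K) :=
  (U.restrictScalars O).map (piMap O K ℓ)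

open nonZeroDivisors in
theorem stmt2_aux_surj {O K : Type*} [CommRing O] [IsDomain O] [IsPrincipalIdealRing O]
    [Field K] [Algebra O K] [IsFractionRing O K]
    (ℓ : ℕ) (U : Submodule K (Fin ℓ → K)) (L : Submodule O (Fin ℓ → O))
    (hL : ∀ v : Fin ℓ → O, v ∈ L ↔ (fun i => algebraMap O K (v i)) ∈ U) :
    Module.finrank O L = Module.finrank K U := by
  let f : L →ₗ[O] U :=
    { toFun := fun v => ⟨fun i => algebraMap O K (v.1 i), (hL v.1).1 v.2⟩
      map_add' := by intro x y; ext i; simp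
      map_smul' := by intro c x; ext i; simp [Algebra.smul_def] }
  have hf : Function.Injective f := by
    intro x y h
    ext i
    have := congrFun (congrArg Subtype.val h) i
    exact IsFractionRing.injective O K this
  have : IsLocalizedModule O⁰ f := by
    refine ⟨?_, ?_, ?_⟩
    · intro x
      have hx : algebraMap O K x ≠ 0 := by
        simpa using nonZeroDivisors.ne_zero x.2
      rw [Module.End.isUnit_iff]
      constructor
      · intro a b h
        have h' : algebraMap O K x • a = algebraMap O K x • b := by
          simpa [Module.algebraMap_end_apply] using h
        exact smul_right_injective _ hx h'
      · intro b
        refine ⟨(algebraMap O K x)⁻¹ • b, ?_⟩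
        rw [Module.algebraMap_end_apply, ← algebraMap_smul K (x : O), smul_smul,
          mul_inv_cancel₀ hx, one_smul]
    · intro y
      obtain ⟨b, hb⟩ := IsLocalization.exist_integer_multiples_of_finite O⁰ y.1
      choose w hw using hb
      have hwU : w ∈ L := by
        rw [hL]
        have : (fun i => algebraMap O K (w i)) = algebraMap O K b • y.1 := by
          ext i; rw [hw]; simp [Algebra.smul_def]
        rw [this]
        exact U.smul_mem _ y.2
      refine ⟨⟨⟨w, hwU⟩, b⟩, ?_⟩
      ext i
      exact (hw i).symm
    · intro x y h
      exact ⟨1, by rw [hf h]⟩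
  rw [← IsLocalizedModule.finrank_eq O⁰ f le_rfl]
  exact (IsLocalization.finrank_eq K O⁰ le_rfl).symm

theorem stmt2_aux_card {O M : Type*} [CommRing O] [IsDomain O] [IsPrincipalIdealRing O]
    [AddCommGroup M] [Module O M]
    (ℓ : ℕ) (L : Submodule O (Fin ℓ → O)) (q : O) (g : L →ₗ[O] M)
    (hg : Function.Surjective g) (hk : ∀ v, g v = 0 ↔ ∃ w, v = q • w) :
    Nat.card M = Nat.card (O ⧸ Ideal.span {q}) ^ Module.finrank O L := by
  let b := Module.finBasis O L
  let h : (Fin (Module.finrank O L) → O) →ₗ[O] M := g.comp b.equivFun.symm.toLinearMap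
  have hh : Function.Surjective h := hg.comp b.equivFun.symm.surjective
  have hker : LinearMap.ker h =
      Submodule.pi Set.univ (fun _ : Fin (Module.finrank O L) => Ideal.span {q}) := by
    ext a
    simp only [LinearMap.mem_ker, Submodule.mem_pi, Set.mem_univ, true_imp_iff,
      Ideal.mem_span_singleton]
    change g (b.equivFun.symm a) = 0 ↔ _
    rw [hk]
    constructor
    · rintro ⟨w, hw⟩ i
      refine ⟨b.equivFun w i, ?_⟩
      have := congrFun (congrArg b.equivFun hw) i
      rw [LinearEquiv.apply_symm_apply, map_smul] at this
      exact this
    · intro ha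
      choose c hc using ha
      refine ⟨b.equivFun.symm c, ?_⟩
      rw [← map_smul]
      congr 1
      ext i
      simp [hc]
  rw [← Nat.card_congr (h.quotKerEquivOfSurjective hh).toEquiv, hker,
    Nat.card_congr (Submodule.quotientPi
      (fun _ : Fin (Module.finrank O L) => Ideal.span {q})).toEquiv, Nat.card_pi]
  simp

theorem piMap_eq_zero_iff {O K : Type*} [CommRing O] [CommRing K] [Algebra O K] {ℓ : ℕ}
    (u : Fin ℓ → K) :
    piMap O K ℓ u = 0 ↔ ∃ w : Fin ℓ → O, ∀ i, algebraMap O K (w i) = u i := by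
  have h1 : piMap O K ℓ u = 0 ↔ ∀ i, u i ∈ OinK O K := by
    rw [funext_iff]
    refine forall_congr' fun i => ?_
    exact Submodule.Quotient.mk_eq_zero _
  rw [h1]
  constructor
  · intro h
    choose w hw using h
    exact ⟨w, hw⟩
  · rintro ⟨w, hw⟩ i
    exact ⟨w i, hw i⟩

/-- For a residually finite PID `O` with fraction field `K`, a prime element `p`, `m ≥ 1`, and a
`K`-subspace `U ⊆ K^ℓ`, the cardinality of the `p^m`-torsion submodule of `π(U)` equals
`N(⟨p^m⟩)^{dim_K U}` where `N(I) = #(O/I)`. -/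
theorem stmt2 {O K : Type*} [CommRing O] [IsDomain O] [IsPrincipalIdealRing O]
    [Field K] [Algebra O K] [IsFractionRing O K]
    (hres : ∀ I : Ideal O, I ≠ ⊥ → Finite (O ⧸ I))
    (ℓ : ℕ) (p : O) (hp : Prime p) (m : ℕ) (hm : 1 ≤ m) (U : Submodule K (Fin ℓ → K)) :
    Nat.card (Submodule.torsionBy O (piU O U) (p ^ m)) =
      Nat.card (O ⧸ Ideal.span {p ^ m}) ^ Module.finrank K U := by
  have hq0 : p ^ m ≠ 0 := pow_ne_zero _ hp.ne_zero
  generalize p ^ m = q at hq0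
  have hq : algebraMap O K q ≠ 0 := by simpa using hq0
  let L : Submodule O (Fin ℓ → O) :=
    (U.restrictScalars O).comap ((Algebra.linearMap O K).compLeft (Fin ℓ))
  have hL : ∀ v : Fin ℓ → O, v ∈ L ↔ (fun i => algebraMap O K (v i)) ∈ U := fun v => Iff.rfl
  rw [← stmt2_aux_surj ℓ U L hL]
  let d : L →ₗ[O] (Fin ℓ → K) :=
    { toFun := fun v => (algebraMap O K q)⁻¹ • fun i => algebraMap O K (v.1 i)
      map_add' := by intro x y; ext i; simp [mul_add]
      map_smul' := by intro c x; ext i; simp [Algebra.smul_def]; ring }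
  have hd : ∀ v : L, ∀ i, d v i = (algebraMap O K q)⁻¹ * algebraMap O K (v.1 i) :=
    fun v i => rfl
  have hdU : ∀ v : L, d v ∈ U := fun v => U.smul_mem _ ((hL _).1 v.2)
  let g1 : L →ₗ[O] piU O U :=
    ((piMap O K ℓ).comp d).codRestrict (piU O U) (fun v => ⟨d v, hdU v, rfl⟩)
  have hg1 : ∀ v, g1 v = 0 ↔ piMap O K ℓ (d v) = 0 := fun v => by
    rw [← Submodule.coe_eq_zero]; rfl
  let g : L →ₗ[O] Submodule.torsionBy O (piU O U) q :=
    g1.codRestrict _ (fun v => by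
      rw [Submodule.mem_torsionBy_iff, ← map_smul, hg1, piMap_eq_zero_iff]
      refine ⟨v.1, fun i => ?_⟩
      rw [hd]
      simp [hq])
  refine stmt2_aux_card ℓ L q g ?_ ?_
  · rintro ⟨⟨x, u, hu, rfl⟩, hx⟩
    rw [Submodule.mem_torsionBy_iff, ← Submodule.coe_eq_zero] at hx
    change q • piMap O K ℓ u = 0 at hx
    rw [← map_smul, piMap_eq_zero_iff] at hx
    obtain ⟨w, hw⟩ := hx
    have hwL : w ∈ L := by
      rw [hL]
      have : (fun i => algebraMap O K (w i)) = algebraMap O K q • u := by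
        ext i; rw [hw]; simp [Algebra.smul_def]
      rw [this]
      exact U.smul_mem _ hu
    refine ⟨⟨w, hwL⟩, ?_⟩
    apply Subtype.ext
    apply Subtype.ext
    change piMap O K ℓ (d ⟨w, hwL⟩) = piMap O K ℓ u
    congr 1
    ext i
    rw [hd]
    simp [hw, Algebra.smul_def, hq]
  · intro v
    have : g v = 0 ↔ g1 v = 0 := by
      rw [← Submodule.coe_eq_zero]; rfl
    rw [this, hg1, piMap_eq_zero_iff]
    constructor
    · rintro ⟨w, hw⟩
      have hwL : w ∈ L := by
        rw [hL]
        have : (fun i => algebraMap O K (w i)) = d v := funext hw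
        rw [this]
        exact hdU v
      refine ⟨⟨w, hwL⟩, ?_⟩
      ext i
      apply IsFractionRing.injective O K
      have := hw i
      rw [hd] at this
      simp [this, hq]
    · rintro ⟨w, rfl⟩
      refine ⟨w.1, fun i => ?_⟩
      rw [hd]
      simp [hq]
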